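/- arXiv:2208.12054 — 6 statements merged into one kernel-verified Lean document; each statement's English description precedes it below -/
import Mathlib

section
/- Let N be a G-stable regular subgroup of Perm(G) and let g ∈ G. Then N_g = φ_g · N · φ_g⁻¹, where φ_g ∈ Perm(G) is the conjugation permutation φ_g(x) = g*x*g⁻¹; that is, conjugating N by ρ(g) gives the same subgroup as conjugating N by the inner automorphism φ_g. -/
/-- The inner automorphism `x ↦ g * x * g⁻¹` is left translation by `g` followed by right
translation by `g⁻¹`. -/
theorem conj_toEquiv_eq_mulRight_mul_mulLeft {G : Type*} [Group G] (g : G) :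
    ((MulAut.conj g).toEquiv : Equiv.Perm G) = Equiv.mulRight g⁻¹ * Equiv.mulLeft g :=
  Equiv.ext fun _ => rfl

/-- A subgroup of `Perm G` stable under conjugation by all left translations is mapped onto
itself by each such conjugation. -/
theorem map_conj_mulLeft_eq_self {G : Type*} [Group G] (N : Subgroup (Equiv.Perm G))
    (hstab : ∀ (h : G), ∀ η ∈ N,
      (Equiv.mulLeft h) * η * (Equiv.mulLeft h)⁻¹ ∈ N)
    (g : G) :
    N.map (MulAut.conj (Equiv.mulLeft g)).toMonoidHom = N := by
  apply le_antisymm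
  · rintro _ ⟨η, hη, rfl⟩
    exact hstab g η hη
  · intro η hη
    refine ⟨_, hstab g⁻¹ η hη, ?_⟩
    ext x
    simp [MulAut.conj_apply]

/-- For a `G`-stable regular subgroup `N` of `Perm G` and `g ∈ G`, conjugating
`N` by `ρ(g) = (x ↦ x * g⁻¹)` gives the same subgroup as conjugating `N` by the inner
automorphism `φ_g = (x ↦ g * x * g⁻¹)`, viewed as a permutation of `G`. -/
theorem rho_conjugate_eq_inner_conjugate {G : Type*} [Group G]
    (N : Subgroup (Equiv.Perm G))
    (hreg : ∀ x y : G, ∃! η : N, (η : Equiv.Perm G) x = y)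
    (hstab : ∀ (h : G), ∀ η ∈ N,
      (Equiv.mulLeft h) * η * (Equiv.mulLeft h)⁻¹ ∈ N)
    (g : G) :
    N.map (MulAut.conj (Equiv.mulRight g⁻¹)).toMonoidHom
      = N.map (MulAut.conj ((MulAut.conj g).toEquiv : Equiv.Perm G)).toMonoidHom := by
  rw [conj_toEquiv_eq_mulRight_mul_mulLeft, map_mul]
  conv_lhs => rw [← map_conj_mulLeft_eq_self N hstab g, Subgroup.map_map]
  rfl
end

section
/- Let N be a G-stable regular subgroup of Perm(G). The evaluation map b : N → G, b(η) = η(1), is a bijection; defining x ⋆ y = b(b⁻¹(x)*b⁻¹(y)) for x, y ∈ G, the operation ⋆ makes G into a group with identity 1 (isomorphic to N via b), and the left skew brace relation holds between ⋆ and the group multiplication of G: x*(y ⋆ z) = (x*y) ⋆ x^{-⋆} ⋆ (x*z) for all x, y, z ∈ G, where x^{-⋆} denotes the inverse of x with respect to ⋆. -/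
noncomputable section

namespace Stmt6

variable {G : Type*} [Group G]

/-- The evaluation map `b : N → G`, `b η = η 1`. -/
def bmap (N : Subgroup (Equiv.Perm G)) (η : N) : G := (η : Equiv.Perm G) 1

/-- A (one-sided) inverse of the evaluation map, via choice. -/
def binv (N : Subgroup (Equiv.Perm G)) : G → N :=
  haveI : Nonempty N := ⟨1⟩
  Function.invFun (bmap N)

/-- The induced operation `x ⋆ y = b (b⁻¹ x * b⁻¹ y)` on `G`. -/
def star (N : Subgroup (Equiv.Perm G)) (x y : G) : G :=
  bmap N (binv N x * binv N y)

/-- The inverse of `x` with respect to `⋆`, namely `b ((b⁻¹ x)⁻¹)`. -/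
def starInv (N : Subgroup (Equiv.Perm G)) (x : G) : G :=
  bmap N ((binv N x)⁻¹)

theorem bmap_bijective {N : Subgroup (Equiv.Perm G)}
    (hreg : ∀ x y : G, ∃! η : N, (η : Equiv.Perm G) x = y) :
    Function.Bijective (bmap N) :=
  Function.bijective_iff_existsUnique _ |>.mpr (hreg 1)

theorem bmap_binv {N : Subgroup (Equiv.Perm G)} (hb : Function.Bijective (bmap N)) (x : G) :
    bmap N (binv N x) = x :=
  Function.rightInverse_invFun hb.surjective x

theorem binv_bmap {N : Subgroup (Equiv.Perm G)} (hb : Function.Bijective (bmap N)) (η : N) :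
    binv N (bmap N η) = η :=
  hb.injective (bmap_binv hb _)

theorem bmap_mul (N : Subgroup (Equiv.Perm G)) (η μ : N) :
    bmap N (η * μ) = (η : Equiv.Perm G) (bmap N μ) := rfl

theorem binv_one {N : Subgroup (Equiv.Perm G)} (hb : Function.Bijective (bmap N)) :
    binv N 1 = 1 :=
  binv_bmap hb 1

/-- By regularity, the conjugate of `b⁻¹ y` by left multiplication by `x` is
`b⁻¹ (x * y) * (b⁻¹ x)⁻¹`, as both lie in `N` and send `x` to `x * y`. -/
theorem conj_binv {N : Subgroup (Equiv.Perm G)}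
    (hreg : ∀ x y : G, ∃! η : N, (η : Equiv.Perm G) x = y)
    (hstab : ∀ (h : G), ∀ η ∈ N,
      (Equiv.mulLeft h) * η * (Equiv.mulLeft h)⁻¹ ∈ N) (x y : G) :
    (⟨_, hstab x _ (binv N y).2⟩ : N) = binv N (x * y) * (binv N x)⁻¹ := by
  have hb := bmap_bijective hreg
  have h (w : G) : (binv N w : Equiv.Perm G) 1 = w := bmap_binv hb w
  refine (hreg x (x * y)).unique ?_ ?_
  · simp [h]
  · have hx : (binv N x : Equiv.Perm G)⁻¹ x = 1 := by
      rw [Equiv.Perm.inv_eq_iff_eq, h]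
    simp only [Subgroup.coe_mul, Subgroup.coe_inv, Equiv.Perm.mul_apply, hx, h]

/-- For a `G`-stable regular subgroup `N` of `Perm G`, the evaluation map
`b : N → G`, `b η = η 1`, is a bijection; the operation `x ⋆ y = b (b⁻¹ x * b⁻¹ y)` makes
`G` into a group with identity `1`, isomorphic to `N` via `b`, and the left skew brace
relation `x * (y ⋆ z) = ((x * y) ⋆ x^{-⋆}) ⋆ (x * z)` holds, where `*` is the group
operation of `G` and `x^{-⋆}` is the `⋆`-inverse of `x`. -/
theorem skew_brace_from_regular_subgroup (N : Subgroup (Equiv.Perm G))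
    (hreg : ∀ x y : G, ∃! η : N, (η : Equiv.Perm G) x = y)
    (hstab : ∀ (h : G), ∀ η ∈ N,
      (Equiv.mulLeft h) * η * (Equiv.mulLeft h)⁻¹ ∈ N) :
    Function.Bijective (bmap N) ∧
    (∀ x y z : G, star N (star N x y) z = star N x (star N y z)) ∧
    (∀ x : G, star N 1 x = x ∧ star N x 1 = x) ∧
    (∀ x : G, star N (starInv N x) x = 1 ∧ star N x (starInv N x) = 1) ∧
    (∀ η μ : N, bmap N (η * μ) = star N (bmap N η) (bmap N μ)) ∧
    (∀ x y z : G,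
      x * star N y z = star N (star N (x * y) (starInv N x)) (x * z)) := by
  have hb := bmap_bijective hreg
  refine ⟨hb, fun x y z => ?_, fun x => ?_, fun x => ?_, fun η μ => ?_, fun x y z => ?_⟩
  · simp only [star, binv_bmap hb, mul_assoc]
  · simp only [star, binv_one hb, one_mul, mul_one, bmap_binv hb, and_self]
  · simp only [star, starInv, binv_bmap hb, inv_mul_cancel, mul_inv_cancel]
    exact ⟨rfl, rfl⟩
  · simp only [star, binv_bmap hb]
  · simp only [star, starInv, binv_bmap hb, ← conj_binv hreg hstab, bmap_mul, bmap_binv hb]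
    simp

end Stmt6
end
end

section
/- Let N be a G-stable regular subgroup of Perm(G), let ⋆ be the induced skew brace operation on G (x ⋆ y = b(b⁻¹(x)*b⁻¹(y)), where b : N → G, b(η) = η(1)), and let g ∈ G. Then ρ(g)·N·ρ(g)⁻¹ = N if and only if g*(x ⋆ y)*g⁻¹ = (g*x*g⁻¹) ⋆ (g*y*g⁻¹) for all x, y ∈ G, i.e. N is normalized by ρ(g) if and only if the inner automorphism φ_g of G is an automorphism of the skew brace (G, ⋆, *). -/
noncomputable section

namespace Stmt8

variable {G : Type*} [Group G]

/-- The evaluation map `b : N → G`, `b η = η 1`. -/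
def bmap (N : Subgroup (Equiv.Perm G)) (η : N) : G := (η : Equiv.Perm G) 1

/-- A (one-sided) inverse of the evaluation map, via choice. -/
def binv (N : Subgroup (Equiv.Perm G)) : G → N :=
  haveI : Nonempty N := ⟨1⟩
  Function.invFun (bmap N)

/-- The induced skew brace operation `x ⋆ y = b (b⁻¹ x * b⁻¹ y)` on `G`. -/
def star (N : Subgroup (Equiv.Perm G)) (x y : G) : G :=
  bmap N (binv N x * binv N y)

theorem binv_apply_one {N : Subgroup (Equiv.Perm G)}
    (hreg : ∀ x y : G, ∃! η : N, (η : Equiv.Perm G) x = y) (x : G) :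
    (binv N x : Equiv.Perm G) 1 = x := by
  obtain ⟨η, hη, -⟩ := hreg 1 x
  exact @Function.invFun_eq _ _ ⟨1⟩ (bmap N) x ⟨η, hη⟩

theorem eq_binv {N : Subgroup (Equiv.Perm G)}
    (hreg : ∀ x y : G, ∃! η : N, (η : Equiv.Perm G) x = y) {η : Equiv.Perm G} (hη : η ∈ N) {x : G}
    (hx : η 1 = x) : η = binv N x :=
  congrArg Subtype.val
    ((hreg 1 x).unique (y₁ := ⟨η, hη⟩) (y₂ := binv N x) hx (binv_apply_one hreg x))

theorem star_eq_binv_apply {N : Subgroup (Equiv.Perm G)}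
    (hreg : ∀ x y : G, ∃! η : N, (η : Equiv.Perm G) x = y) (x y : G) :
    star N x y = (binv N x : Equiv.Perm G) y := by
  simp [star, bmap, binv_apply_one hreg]

theorem star_conj_iff {N : Subgroup (Equiv.Perm G)}
    (hreg : ∀ x y : G, ∃! η : N, (η : Equiv.Perm G) x = y) (g : G) :
    (∀ x y : G, g * star N x y * g⁻¹ = star N (g * x * g⁻¹) (g * y * g⁻¹)) ↔
      ∀ x : G, (MulAut.conj g).toEquiv * (binv N x : Equiv.Perm G) * (MulAut.conj g).toEquiv⁻¹ =
        (binv N (g * x * g⁻¹) : Equiv.Perm G) := by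
  simp only [star_eq_binv_apply hreg]
  refine forall_congr' fun x => ?_
  rw [mul_inv_eq_iff_eq_mul]
  simp [Equiv.ext_iff, Equiv.Perm.mul_apply]

theorem mulLeft_mul_mulRight_inv (g : G) :
    Equiv.mulLeft g * Equiv.mulRight g⁻¹ = ((MulAut.conj g).toEquiv : Equiv.Perm G) := by
  ext x
  simp [mul_assoc]

theorem mulLeft_conj_mem_iff {N : Subgroup (Equiv.Perm G)}
    (hstab : ∀ (h : G), ∀ η ∈ N, (Equiv.mulLeft h) * η * (Equiv.mulLeft h)⁻¹ ∈ N)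
    (g : G) (η : Equiv.Perm G) :
    Equiv.mulLeft g * η * (Equiv.mulLeft g)⁻¹ ∈ N ↔ η ∈ N := by
  refine ⟨fun h => ?_, hstab g η⟩
  convert hstab g⁻¹ _ h using 1
  ext x
  simp [Equiv.Perm.mul_apply]

theorem map_conj_eq_iff {K : Type*} [Group K] (N : Subgroup K) (a : K) :
    N.map (MulAut.conj a).toMonoidHom = N ↔ ∀ n : K, n ∈ N ↔ a * n * a⁻¹ ∈ N := by
  constructor
  · intro h n
    conv_rhs => rw [← h]
    exact (Subgroup.mem_map_iff_mem (f := (MulAut.conj a).toMonoidHom)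
      (MulAut.conj a).injective).symm
  · intro h
    ext n
    rw [Subgroup.mem_map]
    refine ⟨?_, fun hn => ⟨a⁻¹ * n * a, (h _).2 ?_, ?_⟩⟩
    · rintro ⟨m, hm, rfl⟩
      exact (h m).1 hm
    · simpa [mul_assoc] using hn
    · simp [mul_assoc]

/-- Let `N` be a `G`-stable regular subgroup of `Perm G`, `⋆` the induced
skew brace operation on `G`, and `g ∈ G`.  Then `ρ(g) N ρ(g)⁻¹ = N` if and only if
`g * (x ⋆ y) * g⁻¹ = (g * x * g⁻¹) ⋆ (g * y * g⁻¹)` for all `x, y ∈ G`; that is, `N` is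
normalized by `ρ(g)` if and only if the inner automorphism `φ_g` is an automorphism of
the skew brace `(G, ⋆, *)`. -/
theorem rho_normalizes_iff_conj_brace_automorphism (N : Subgroup (Equiv.Perm G))
    (hreg : ∀ x y : G, ∃! η : N, (η : Equiv.Perm G) x = y)
    (hstab : ∀ (h : G), ∀ η ∈ N,
      (Equiv.mulLeft h) * η * (Equiv.mulLeft h)⁻¹ ∈ N)
    (g : G) :
    N.map (MulAut.conj (Equiv.mulRight g⁻¹)).toMonoidHom = N
      ↔ ∀ x y : G,
          g * star N x y * g⁻¹ = star N (g * x * g⁻¹) (g * y * g⁻¹) := by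
  rw [star_conj_iff hreg, map_conj_eq_iff]
  have key : ∀ η : Equiv.Perm G,
      Equiv.mulRight g⁻¹ * η * (Equiv.mulRight g⁻¹)⁻¹ ∈ N ↔
        (MulAut.conj g).toEquiv * η * (MulAut.conj g).toEquiv⁻¹ ∈ N := by
    intro η
    rw [← mulLeft_conj_mem_iff hstab g, ← mulLeft_mul_mulRight_inv, mul_inv_rev]
    simp only [mul_assoc]
  simp only [key]
  constructor
  · intro h x
    refine eq_binv hreg ((h _).1 (binv N x).2) ?_
    simp [Equiv.Perm.mul_apply, binv_apply_one hreg]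
  · intro h η
    constructor
    · intro hη
      rw [eq_binv hreg hη rfl, h]
      exact (binv N _).2
    · intro hη
      have hx := h (η 1)
      have hc : (MulAut.conj g).toEquiv * η * (MulAut.conj g).toEquiv⁻¹ =
          (binv N (g * η 1 * g⁻¹) : Equiv.Perm G) :=
        eq_binv hreg hη (by simp [Equiv.Perm.mul_apply])
      have he : η = binv N (η 1) := mul_left_cancel (mul_right_cancel (hc.trans hx.symm))
      rw [he]
      exact (binv N _).2

end Stmt8
end
end

section
/- Let G be a finite group, N a G-stable regular subgroup of Perm(G), and ⋆ the induced skew brace operation on G. Let G' = {g ∈ G : g*(x ⋆ y)*g⁻¹ = (g*x*g⁻¹) ⋆ (g*y*g⁻¹) for all x, y ∈ G}. Then G' is a subgroup of G, and the number of distinct subgroups among {N_g : g ∈ G} equals |G| / |G'|. -/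
noncomputable section

namespace Stmt9

variable {G : Type*} [Group G]

/-- The evaluation map `b : N → G`, `b η = η 1`. -/
def bmap (N : Subgroup (Equiv.Perm G)) (η : N) : G := (η : Equiv.Perm G) 1

/-- A (one-sided) inverse of the evaluation map, via choice. -/
def binv (N : Subgroup (Equiv.Perm G)) : G → N :=
  haveI : Nonempty N := ⟨1⟩
  Function.invFun (bmap N)

/-- The induced skew brace operation `x ⋆ y = b (b⁻¹ x * b⁻¹ y)` on `G`. -/
def star (N : Subgroup (Equiv.Perm G)) (x y : G) : G :=
  bmap N (binv N x * binv N y)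

/-- `N_g = ρ(g) N ρ(g)⁻¹`, where `ρ(g) = (x ↦ x * g⁻¹)`. -/
def Ng (N : Subgroup (Equiv.Perm G)) (g : G) : Subgroup (Equiv.Perm G) :=
  N.map (MulAut.conj (Equiv.mulRight g⁻¹)).toMonoidHom

open scoped Pointwise

theorem binv_apply_one {N : Subgroup (Equiv.Perm G)}
    (hreg : ∀ x y : G, ∃! η : N, (η : Equiv.Perm G) x = y) (x : G) :
    (binv N x : Equiv.Perm G) 1 = x :=
  haveI : Nonempty N := ⟨1⟩
  Function.invFun_eq (f := bmap N) (hreg 1 x).exists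

theorem star_eq_binv_apply {N : Subgroup (Equiv.Perm G)}
    (hreg : ∀ x y : G, ∃! η : N, (η : Equiv.Perm G) x = y) (x y : G) :
    star N x y = (binv N x : Equiv.Perm G) y := by
  simp [star, bmap, binv_apply_one hreg]

theorem eq_binv_of_mem {N : Subgroup (Equiv.Perm G)}
    (hreg : ∀ x y : G, ∃! η : N, (η : Equiv.Perm G) x = y)
    {η : Equiv.Perm G} (hη : η ∈ N) : η = binv N (η 1) :=
  congrArg Subtype.val
    ((hreg 1 (η 1)).unique (y₁ := ⟨η, hη⟩) rfl (binv_apply_one hreg _))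

/-- Right translation `g ↦ (x ↦ x * g⁻¹)` as a homomorphism into `Perm G`. -/
def rho : G →* Equiv.Perm G where
  toFun g := Equiv.mulRight g⁻¹
  map_one' := by ext; simp
  map_mul' a b := by ext; simp [mul_assoc]

/-- The action of `G` on subgroups of `Perm G` by conjugation through `rho`. -/
@[reducible] def rhoAction : MulAction G (Subgroup (Equiv.Perm G)) :=
  MulAction.compHom _ ((MulAut.conj (G := Equiv.Perm G)).comp rho)

theorem map_conj_mulLeft {N : Subgroup (Equiv.Perm G)}
    (hstab : ∀ (h : G), ∀ η ∈ N,
      (Equiv.mulLeft h) * η * (Equiv.mulLeft h)⁻¹ ∈ N) (g : G) :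
    N.map (MulAut.conj (Equiv.mulLeft g)).toMonoidHom = N := by
  apply le_antisymm
  · rintro _ ⟨η, hη, rfl⟩
    exact hstab g η hη
  · intro η hη
    refine ⟨_, hstab g⁻¹ η hη, ?_⟩
    ext x
    simp

/-- By `G`-stability, `N_g` is the image of `N` under the inner automorphism of `g`. -/
theorem Ng_eq_map_conj {N : Subgroup (Equiv.Perm G)}
    (hstab : ∀ (h : G), ∀ η ∈ N,
      (Equiv.mulLeft h) * η * (Equiv.mulLeft h)⁻¹ ∈ N) (g : G) :
    Ng N g = N.map (MulAut.conj (MulAut.conj g).toEquiv).toMonoidHom := by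
  conv_lhs => rw [← map_conj_mulLeft hstab g]
  rw [Ng, Subgroup.map_map]
  congr 1
  ext η x
  simp [mul_assoc]

theorem Ng_eq_self_iff [Finite G] {N : Subgroup (Equiv.Perm G)}
    (hreg : ∀ x y : G, ∃! η : N, (η : Equiv.Perm G) x = y)
    (hstab : ∀ (h : G), ∀ η ∈ N,
      (Equiv.mulLeft h) * η * (Equiv.mulLeft h)⁻¹ ∈ N) (g : G) :
    Ng N g = N ↔ ∀ x y : G,
      g * star N x y * g⁻¹ = star N (g * x * g⁻¹) (g * y * g⁻¹) := by
  rw [Ng_eq_map_conj hstab]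
  simp only [star_eq_binv_apply hreg]
  constructor
  · intro h x y
    have hmem := h.le (Subgroup.mem_map_of_mem _ (binv N x).2)
    have h := congrArg (fun e : Equiv.Perm G => e (g * y * g⁻¹)) (eq_binv_of_mem hreg hmem)
    simpa [mul_assoc, binv_apply_one hreg] using h
  · intro h
    refine Subgroup.eq_of_le_of_card_ge ?_ ?_
    · rintro _ ⟨η, hη, rfl⟩
      convert (binv N (g * η 1 * g⁻¹)).2 using 1
      ext y
      have h := h (η 1) (g⁻¹ * y * g)
      rw [← eq_binv_of_mem hreg hη] at h
      simpa [mul_assoc] using h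
    · exact (Nat.card_congr (N.equivMapOfInjective _ (MulEquiv.injective _)).toEquiv).le

/-- Let `G` be a finite group, `N` a `G`-stable regular subgroup of
`Perm G`, and `⋆` the induced skew brace operation.  Let
`G' = {g ∈ G | ∀ x y, g * (x ⋆ y) * g⁻¹ = (g * x * g⁻¹) ⋆ (g * y * g⁻¹)}`.  Then `G'`
is a subgroup of `G`, and the number of distinct subgroups among `{N_g : g ∈ G}`
equals `|G| / |G'|`. -/
theorem card_rho_conjugates [Finite G] (N : Subgroup (Equiv.Perm G))
    (hreg : ∀ x y : G, ∃! η : N, (η : Equiv.Perm G) x = y)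
    (hstab : ∀ (h : G), ∀ η ∈ N,
      (Equiv.mulLeft h) * η * (Equiv.mulLeft h)⁻¹ ∈ N) :
    (∃ G' : Subgroup G, (G' : Set G) =
        {g : G | ∀ x y : G,
          g * star N x y * g⁻¹ = star N (g * x * g⁻¹) (g * y * g⁻¹)}) ∧
    Nat.card (Set.range fun g : G => Ng N g)
      = Nat.card G /
        Nat.card {g : G | ∀ x y : G,
          g * star N x y * g⁻¹ = star N (g * x * g⁻¹) (g * y * g⁻¹)} := by
  let _ : MulAction G (Subgroup (Equiv.Perm G)) := rhoAction
  have hG' : (MulAction.stabilizer G N : Set G) = {g : G | ∀ x y : G,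
      g * star N x y * g⁻¹ = star N (g * x * g⁻¹) (g * y * g⁻¹)} :=
    Set.ext fun g => Ng_eq_self_iff hreg hstab g
  refine ⟨⟨_, hG'⟩, ?_⟩
  rw [← hG']
  change Nat.card (MulAction.orbit G N) = Nat.card G / Nat.card (MulAction.stabilizer G N)
  rw [← Subgroup.index_mul_card (MulAction.stabilizer G N), Nat.mul_div_cancel _ Nat.card_pos,
    MulAction.index_stabilizer, Nat.card_coe_set_eq]

end Stmt9
end
end

section
/- Let N be a G-stable regular subgroup of Perm(G) and ⋆ the induced skew brace operation on G. Then ρ(g)·N·ρ(g)⁻¹ = N for every g ∈ G if and only if the right skew brace relation holds for (G, ⋆, *): (y ⋆ z)*x = (y*x) ⋆ x^{-⋆} ⋆ (z*x) for all x, y, z ∈ G, where x^{-⋆} is the ⋆-inverse of x; that is, N is normalized by ρ(G) if and only if (G, ⋆, *) is a two-sided skew brace. -/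
noncomputable section

namespace Stmt10

variable {G : Type*} [Group G]

/-- The evaluation map `b : N → G`, `b η = η 1`. -/
def bmap (N : Subgroup (Equiv.Perm G)) (η : N) : G := (η : Equiv.Perm G) 1

/-- A (one-sided) inverse of the evaluation map, via choice. -/
def binv (N : Subgroup (Equiv.Perm G)) : G → N :=
  haveI : Nonempty N := ⟨1⟩
  Function.invFun (bmap N)

/-- The induced skew brace operation `x ⋆ y = b (b⁻¹ x * b⁻¹ y)` on `G`. -/
def star (N : Subgroup (Equiv.Perm G)) (x y : G) : G :=
  bmap N (binv N x * binv N y)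

/-- The inverse of `x` with respect to `⋆`, namely `b ((b⁻¹ x)⁻¹)`. -/
def starInv (N : Subgroup (Equiv.Perm G)) (x : G) : G :=
  bmap N ((binv N x)⁻¹)

theorem binv_apply_one (N : Subgroup (Equiv.Perm G))
    (hreg : ∀ x y : G, ∃! η : N, (η : Equiv.Perm G) x = y) (x : G) :
    (binv N x : Equiv.Perm G) 1 = x := by
  have : Nonempty N := ⟨1⟩
  exact Function.invFun_eq (f := bmap N) (hreg 1 x).exists

theorem binv_apply_self_one (N : Subgroup (Equiv.Perm G))
    (hreg : ∀ x y : G, ∃! η : N, (η : Equiv.Perm G) x = y) (η : N) :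
    binv N ((η : Equiv.Perm G) 1) = η :=
  (hreg 1 ((η : Equiv.Perm G) 1)).unique (binv_apply_one N hreg _) rfl

theorem star_eq_binv_apply (N : Subgroup (Equiv.Perm G))
    (hreg : ∀ x y : G, ∃! η : N, (η : Equiv.Perm G) x = y) (y z : G) :
    star N y z = (binv N y : Equiv.Perm G) z :=
  congrArg (binv N y : Equiv.Perm G) (binv_apply_one N hreg z)

theorem star_star_starInv (N : Subgroup (Equiv.Perm G))
    (hreg : ∀ x y : G, ∃! η : N, (η : Equiv.Perm G) x = y) (x y z : G) :
    star N (star N y (starInv N x)) z =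
      ((binv N y * (binv N x)⁻¹ : N) : Equiv.Perm G) z := by
  rw [star_eq_binv_apply N hreg, star_eq_binv_apply N hreg]
  exact congrArg (fun η : N => (η : Equiv.Perm G) z)
    (binv_apply_self_one N hreg (binv N y * (binv N x)⁻¹))

/-- Let `N` be a `G`-stable regular subgroup of `Perm G` and `⋆` the
induced skew brace operation on `G`.  Then `ρ(g) N ρ(g)⁻¹ = N` for every `g ∈ G` if and
only if the right skew brace relation `(y ⋆ z) * x = ((y * x) ⋆ x^{-⋆}) ⋆ (z * x)`
holds for all `x, y, z ∈ G`; that is, `N` is normalized by `ρ(G)` if and only if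
`(G, ⋆, *)` is a two-sided skew brace. -/
theorem rho_G_normalizes_iff_two_sided (N : Subgroup (Equiv.Perm G))
    (hreg : ∀ x y : G, ∃! η : N, (η : Equiv.Perm G) x = y)
    (hstab : ∀ (h : G), ∀ η ∈ N,
      (Equiv.mulLeft h) * η * (Equiv.mulLeft h)⁻¹ ∈ N) :
    (∀ g : G, N.map (MulAut.conj (Equiv.mulRight g⁻¹)).toMonoidHom = N)
      ↔ ∀ x y z : G,
          star N y z * x = star N (star N (y * x) (starInv N x)) (z * x) := by
  simp only [star_star_starInv N hreg]
  simp only [star_eq_binv_apply N hreg]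
  constructor
  · intro hN x y z
    have hmem : Equiv.mulRight x * (binv N y : Equiv.Perm G) * (Equiv.mulRight x)⁻¹ ∈ N := by
      have h := Subgroup.mem_map_of_mem
        (MulAut.conj (Equiv.mulRight x⁻¹⁻¹)).toMonoidHom (binv N y).2
      rw [hN x⁻¹, inv_inv] at h
      exact h
    have heq : (⟨_, hmem⟩ : N) = binv N (y * x) * (binv N x)⁻¹ := by
      refine (hreg x (y * x)).unique ?_ ?_
      · simp [Equiv.Perm.mul_apply, binv_apply_one N hreg]
      · have hx : (binv N x : Equiv.Perm G)⁻¹ x = 1 :=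
          Equiv.Perm.inv_eq_iff_eq.2 (binv_apply_one N hreg x).symm
        simp [Equiv.Perm.mul_apply, hx, binv_apply_one N hreg]
    rw [← heq]
    simp [Equiv.Perm.mul_apply]
  · intro h
    have hmem (x : G) (η : Equiv.Perm G) (hη : η ∈ N) :
        Equiv.mulRight x * η * (Equiv.mulRight x)⁻¹ ∈ N := by
      have heq : Equiv.mulRight x * η * (Equiv.mulRight x)⁻¹ =
          ((binv N (η 1 * x) * (binv N x)⁻¹ : N) : Equiv.Perm G) := by
        ext z
        have hz := h x (η 1) (z * x⁻¹)
        rw [binv_apply_self_one N hreg ⟨η, hη⟩, inv_mul_cancel_right] at hz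
        simpa [Equiv.Perm.mul_apply] using hz
      exact heq ▸ SetLike.coe_mem _
    intro g
    apply le_antisymm
    · rintro _ ⟨η, hη, rfl⟩
      exact hmem g⁻¹ η hη
    · intro η hη
      refine ⟨_, hmem g η hη, ?_⟩
      ext z
      simp [Equiv.Perm.mul_apply]

end Stmt10
end
end

section
/- Let ψ : G → G be an abelian map and g ∈ G. Then ψ' := φ_g ∘ ψ ∘ φ_{g⁻¹} (i.e. ψ'(h) = g*ψ(g⁻¹*h*g)*g⁻¹) is an abelian map on G, and N_{ψ'} = φ_g · N_ψ · φ_g⁻¹ = {φ_g ∘ ν ∘ φ_g⁻¹ : ν ∈ N_ψ}, where φ_g ∈ Perm(G) is conjugation by g; indeed φ_g ∘ η_ψ(g⁻¹*h*g) ∘ φ_g⁻¹ = η_{ψ'}(h) for every h ∈ G. -/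
namespace Stmt16

variable {G : Type*} [Group G]

/-- For a map `ψ : G → G` and `h ∈ G`, the permutation
`η_ψ(h) : x ↦ h * ψ(h)⁻¹ * x * ψ(h)` of `G`. -/
def etaMap (ψ : G → G) (h : G) : Equiv.Perm G :=
  (Equiv.mulRight (ψ h)).trans (Equiv.mulLeft (h * (ψ h)⁻¹))

/-- `N_ψ = {η_ψ(h) : h ∈ G}`. -/
def NMap (ψ : G → G) : Set (Equiv.Perm G) := Set.range (etaMap ψ)

/-- The conjugated map `ψ' = φ_g ∘ ψ ∘ φ_{g⁻¹}`, i.e. `ψ'(h) = g * ψ(g⁻¹ * h * g) * g⁻¹`. -/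
def psiConj (ψ : G → G) (g : G) : G → G := fun h => g * ψ (g⁻¹ * h * g) * g⁻¹

theorem conj_mul_etaMap_mul_conj_inv (ψ : G → G) (g h : G) :
    ((MulAut.conj g).toEquiv : Equiv.Perm G) * etaMap ψ (g⁻¹ * h * g) *
        ((MulAut.conj g).toEquiv : Equiv.Perm G)⁻¹
      = etaMap (psiConj ψ g) h := by
  rw [mul_inv_eq_iff_eq_mul]
  ext x
  simp [etaMap, psiConj, mul_assoc]

theorem image_conj_NMap (ψ : G → G) (g : G) :
    (fun ν : Equiv.Perm G =>
        ((MulAut.conj g).toEquiv : Equiv.Perm G) * ν *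
          ((MulAut.conj g).toEquiv : Equiv.Perm G)⁻¹) '' NMap ψ
      = NMap (psiConj ψ g) := by
  ext ν
  constructor
  · rintro ⟨_, ⟨h, rfl⟩, rfl⟩
    refine ⟨g * h * g⁻¹, ?_⟩
    rw [← conj_mul_etaMap_mul_conj_inv]
    simp [mul_assoc]
  · rintro ⟨h, rfl⟩
    exact ⟨_, ⟨g⁻¹ * h * g, rfl⟩, conj_mul_etaMap_mul_conj_inv ψ g h⟩

/-- If `ψ : G → G` is an abelian map (an endomorphism with commutative
image) and `g ∈ G`, then `ψ' = φ_g ∘ ψ ∘ φ_{g⁻¹}` is an abelian map on `G`, the subgroup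
`N_{ψ'}` is the conjugate `φ_g ∘ N_ψ ∘ φ_g⁻¹` of `N_ψ` by the conjugation permutation
`φ_g`; indeed `φ_g ∘ η_ψ(g⁻¹ * h * g) ∘ φ_g⁻¹ = η_{ψ'}(h)` for every `h ∈ G`. -/
theorem abelian_map_conjugate (ψ : G →* G)
    (hab : ∀ x y : G, ψ x * ψ y = ψ y * ψ x) (g : G) :
    -- ψ' is a group endomorphism:
    (∀ x y : G, psiConj (⇑ψ) g (x * y) = psiConj (⇑ψ) g x * psiConj (⇑ψ) g y) ∧
    -- ψ' is abelian:
    (∀ x y : G, psiConj (⇑ψ) g x * psiConj (⇑ψ) g y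
        = psiConj (⇑ψ) g y * psiConj (⇑ψ) g x) ∧
    -- N_{ψ'} = φ_g ∘ N_ψ ∘ φ_g⁻¹:
    ((fun ν : Equiv.Perm G =>
        ((MulAut.conj g).toEquiv : Equiv.Perm G) * ν *
          ((MulAut.conj g).toEquiv : Equiv.Perm G)⁻¹) '' NMap (⇑ψ)
      = NMap (psiConj (⇑ψ) g)) ∧
    -- pointwise: φ_g ∘ η_ψ(g⁻¹ h g) ∘ φ_g⁻¹ = η_{ψ'}(h):
    (∀ h : G,
      ((MulAut.conj g).toEquiv : Equiv.Perm G) * etaMap (⇑ψ) (g⁻¹ * h * g) *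
          ((MulAut.conj g).toEquiv : Equiv.Perm G)⁻¹
        = etaMap (psiConj (⇑ψ) g) h) := by
  refine ⟨fun x y => ?_, fun x y => ?_, image_conj_NMap ψ g,
    conj_mul_etaMap_mul_conj_inv ψ g⟩
  · simp [psiConj, mul_assoc]
  · have h := hab (g⁻¹ * x * g) (g⁻¹ * y * g)
    calc psiConj (⇑ψ) g x * psiConj (⇑ψ) g y
        = g * (ψ (g⁻¹ * x * g) * ψ (g⁻¹ * y * g)) * g⁻¹ := by
          simp only [psiConj]; group
      _ = g * (ψ (g⁻¹ * y * g) * ψ (g⁻¹ * x * g)) * g⁻¹ := by rw [h]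
      _ = psiConj (⇑ψ) g y * psiConj (⇑ψ) g x := by
          simp only [psiConj]; group

end Stmt16
end
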